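/- arXiv:2601.22568 — 2 statements merged into one kernel-verified Lean document; each statement's English description precedes it below -/
import Mathlib

section
/- Let 0 < q < 1 and 0 < qs < 1. Let ρ_1, …, ρ_n be positive semidefinite complex d × d matrices each of trace 1, let p_1, …, p_n be nonnegative reals with Σ_i p_i = 1, and set ρ = Σ_i p_i ρ_i. Then (Tr ρ^q)^s − 1 ≥ Σ_i p_i ((Tr ρ_i^q)^s − 1); that is, the function ρ ↦ (Tr ρ^q)^s − 1 is concave on density matrices. -/
open scoped ComplexOrder

/-- `Tr σ^r := Σ_i μ_i^r` where `μ_i` are the eigenvalues of the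
(Hermitian) matrix `σ`, with real powers. -/
noncomputable def trRpow {d : ℕ} (ρ : Matrix (Fin d) (Fin d) ℂ) (r : ℝ) : ℝ :=
  letI := Classical.dec ρ.IsHermitian
  if h : ρ.IsHermitian then ∑ i, h.eigenvalues i ^ r else 0

/-- The reverse Minkowski inequality for a weighted family of nonnegative vectors and an exponent
`0 < q ≤ 1`. -/
theorem sum_mul_rpow_sum_rpow_le {ι κ : Type*} [Fintype ι] [Fintype κ] {q : ℝ} (hq0 : 0 < q)
    (hq1 : q ≤ 1) (p : ι → ℝ) (hp : ∀ i, 0 ≤ p i) (a : ι → κ → ℝ) (ha : ∀ i k, 0 ≤ a i k) :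
    ∑ i, p i * (∑ k, a i k ^ q) ^ q⁻¹ ≤ (∑ k, (∑ i, p i * a i k) ^ q) ^ q⁻¹ := by
  have hq : q⁻¹ ≠ 0 := inv_ne_zero hq0.ne'
  have htoReal : (ENNReal.ofReal q⁻¹).toReal = q⁻¹ := ENNReal.toReal_ofReal (by positivity)
  have : Fact (1 ≤ ENNReal.ofReal q⁻¹) :=
    ⟨by simpa using ENNReal.ofReal_le_ofReal ((one_le_inv₀ hq0).2 hq1)⟩
  have hnorm (f : ι → ℝ) (hf : ∀ i, 0 ≤ f i) :
      ‖WithLp.toLp (ENNReal.ofReal q⁻¹) f‖ = (∑ i, f i ^ q⁻¹) ^ q := by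
    rw [PiLp.norm_eq_sum (by rw [htoReal]; positivity), htoReal, one_div, inv_inv]
    simp only [Real.norm_eq_abs, abs_of_nonneg (hf _)]
  have hnonneg (i : ι) (k : κ) : 0 ≤ (p i * a i k) ^ q :=
    Real.rpow_nonneg (mul_nonneg (hp i) (ha i k)) q
  have hle := norm_sum_le Finset.univ fun k ↦
    WithLp.toLp (ENNReal.ofReal q⁻¹) fun i ↦ (p i * a i k) ^ q
  rw [← WithLp.toLp_sum, hnorm _ fun i ↦ by
    simpa using Finset.sum_nonneg fun k _ ↦ hnonneg i k] at hle
  simp only [Finset.sum_apply, hnorm _ fun i ↦ hnonneg i _,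
    Real.rpow_rpow_inv (mul_nonneg (hp _) (ha _ _)) hq0.ne'] at hle
  have hlhs (i : ι) : (∑ k, (p i * a i k) ^ q) ^ q⁻¹ = p i * (∑ k, a i k ^ q) ^ q⁻¹ := by
    simp only [Real.mul_rpow (hp i) (ha i _), ← Finset.mul_sum]
    rw [Real.mul_rpow (Real.rpow_nonneg (hp i) q)
      (Finset.sum_nonneg fun k _ ↦ Real.rpow_nonneg (ha i k) q), Real.rpow_rpow_inv (hp i) hq0.ne']
  simp only [hlhs] at hle
  have hsum : 0 ≤ ∑ i, p i * (∑ k, a i k ^ q) ^ q⁻¹ :=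
    Finset.sum_nonneg fun i _ ↦ mul_nonneg (hp i) <| Real.rpow_nonneg
      (Finset.sum_nonneg fun k _ ↦ Real.rpow_nonneg (ha i k) q) _
  exact (Real.le_rpow_inv_iff_of_pos hsum ((Real.rpow_nonneg hsum q).trans hle) hq0).2 hle

namespace Matrix

variable {n : Type*} [Fintype n] [DecidableEq n]

theorem sum_norm_sq_row_of_mem_unitaryGroup {W : Matrix n n ℂ} (hW : W ∈ unitaryGroup n ℂ)
    (j : n) : ∑ k, ‖W j k‖ ^ 2 = 1 := by
  have h := congr_fun₂ (mem_unitaryGroup_iff.1 hW) j j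
  simp only [mul_apply, star_apply, one_apply_eq, RCLike.star_def, Complex.mul_conj'] at h
  exact_mod_cast h

theorem sum_norm_sq_col_of_mem_unitaryGroup {W : Matrix n n ℂ} (hW : W ∈ unitaryGroup n ℂ)
    (k : n) : ∑ j, ‖W j k‖ ^ 2 = 1 := by
  simpa using sum_norm_sq_row_of_mem_unitaryGroup (Unitary.star_mem hW) k

theorem IsHermitian.re_diag_unitary_conj {A : Matrix n n ℂ} (hA : A.IsHermitian)
    (U : Matrix n n ℂ) (k : n) :
    ((star U * A * U) k k).re =
      ∑ j, ‖(star (hA.eigenvectorUnitary : Matrix n n ℂ) * U) j k‖ ^ 2 * hA.eigenvalues j := by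
  set V : Matrix n n ℂ := hA.eigenvectorUnitary.1
  have hconj : star U * A * U =
      star (star V * U) * diagonal (RCLike.ofReal ∘ hA.eigenvalues) * (star V * U) := by
    conv_lhs => rw [hA.spectral_theorem, Unitary.conjStarAlgAut_apply]
    simp only [star_mul, star_star, mul_assoc, V]
  have hentry (j : n) : (star ((star V * U) j k) * (hA.eigenvalues j : ℂ) * (star V * U) j k) =
      ((‖(star V * U) j k‖ ^ 2 * hA.eigenvalues j : ℝ) : ℂ) := by
    rw [mul_right_comm, RCLike.star_def, Complex.conj_mul']
    push_cast
    rfl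
  rw [hconj, mul_apply]
  simp only [mul_diagonal, star_apply, Function.comp_apply, Complex.coe_algebraMap, hentry,
    ← Complex.ofReal_sum, Complex.ofReal_re]

/-- **Peierls inequality** for the concave function `x ↦ x ^ q`. -/
theorem PosSemidef.sum_eigenvalues_rpow_le {A : Matrix n n ℂ} (hA : A.PosSemidef)
    {U : Matrix n n ℂ} (hU : U ∈ unitaryGroup n ℂ) {q : ℝ} (hq0 : 0 ≤ q) (hq1 : q ≤ 1) :
    ∑ j, hA.isHermitian.eigenvalues j ^ q ≤ ∑ k, ((star U * A * U) k k).re ^ q := by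
  set W : Matrix n n ℂ := star (hA.isHermitian.eigenvectorUnitary : Matrix n n ℂ) * U
  have hW : W ∈ unitaryGroup n ℂ :=
    mul_mem (Unitary.star_mem hA.isHermitian.eigenvectorUnitary.2) hU
  calc ∑ j, hA.isHermitian.eigenvalues j ^ q
      = ∑ k, ∑ j, ‖W j k‖ ^ 2 * hA.isHermitian.eigenvalues j ^ q := by
        rw [Finset.sum_comm]
        simp only [← Finset.sum_mul, sum_norm_sq_row_of_mem_unitaryGroup hW, one_mul]
    _ ≤ ∑ k, ((star U * A * U) k k).re ^ q := by
        refine Finset.sum_le_sum fun k _ ↦ ?_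
        rw [hA.isHermitian.re_diag_unitary_conj U k]
        exact (Real.concaveOn_rpow hq0 hq1).le_map_sum (fun j _ ↦ sq_nonneg _)
          (sum_norm_sq_col_of_mem_unitaryGroup hW k) fun j _ ↦ hA.eigenvalues_nonneg j

theorem IsHermitian.re_diag_eigenvectorUnitary_conj {A : Matrix n n ℂ} (hA : A.IsHermitian)
    (k : n) : ((star (hA.eigenvectorUnitary : Matrix n n ℂ) * A *
      (hA.eigenvectorUnitary : Matrix n n ℂ)) k k).re = hA.eigenvalues k := by
  rw [← Unitary.conjStarAlgAut_star_apply (S := ℂ), hA.conjStarAlgAut_star_eigenvectorUnitary]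
  simp

end Matrix

theorem trRpow_of_isHermitian {d : ℕ} {ρ : Matrix (Fin d) (Fin d) ℂ} (h : ρ.IsHermitian) (r : ℝ) :
    trRpow ρ r = ∑ i, h.eigenvalues i ^ r :=
  dif_pos h

theorem trRpow_nonneg {d : ℕ} {ρ : Matrix (Fin d) (Fin d) ℂ} (h : ρ.PosSemidef) (r : ℝ) :
    0 ≤ trRpow ρ r := by
  rw [trRpow_of_isHermitian h.isHermitian]
  exact Finset.sum_nonneg fun i _ ↦ Real.rpow_nonneg (h.eigenvalues_nonneg i) r

theorem Matrix.PosSemidef.sum_ofReal_smul {ι m : Type*} [Fintype ι] {ρ : ι → Matrix m m ℂ}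
    (hρ : ∀ i, (ρ i).PosSemidef) {p : ι → ℝ} (hp : ∀ i, 0 ≤ p i) :
    (∑ i, (p i : ℂ) • ρ i).PosSemidef :=
  Matrix.posSemidef_sum _ fun i _ ↦ (hρ i).smul (Complex.zero_le_real.2 (hp i))

/-- The reverse Minkowski inequality for the Schatten quasi-norms with exponent `0 < q ≤ 1`. -/
theorem sum_mul_trRpow_rpow_inv_le {ι : Type*} [Fintype ι] {d : ℕ} {q : ℝ} (hq0 : 0 < q)
    (hq1 : q ≤ 1) {ρ : ι → Matrix (Fin d) (Fin d) ℂ} (hρ : ∀ i, (ρ i).PosSemidef)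
    {p : ι → ℝ} (hp : ∀ i, 0 ≤ p i) :
    ∑ i, p i * trRpow (ρ i) q ^ q⁻¹ ≤ trRpow (∑ i, (p i : ℂ) • ρ i) q ^ q⁻¹ := by
  have hH := (Matrix.PosSemidef.sum_ofReal_smul hρ hp).isHermitian
  set U : Matrix (Fin d) (Fin d) ℂ := hH.eigenvectorUnitary.1
  have hdiag (i : ι) (k : Fin d) : 0 ≤ ((star U * ρ i * U) k k).re :=
    (Complex.nonneg_iff.1 ((hρ i).conjTranspose_mul_mul_same U).diag_nonneg).1
  have heig (k : Fin d) :
      hH.eigenvalues k = ∑ i, p i * ((star U * ρ i * U) k k).re := by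
    rw [← hH.re_diag_eigenvectorUnitary_conj k]
    simp [U, Finset.mul_sum, Finset.sum_mul, Matrix.sum_apply]
  calc ∑ i, p i * trRpow (ρ i) q ^ q⁻¹
      ≤ ∑ i, p i * (∑ k, ((star U * ρ i * U) k k).re ^ q) ^ q⁻¹ := by
        refine Finset.sum_le_sum fun i _ ↦ mul_le_mul_of_nonneg_left ?_ (hp i)
        refine Real.rpow_le_rpow (trRpow_nonneg (hρ i) q) ?_ (inv_nonneg.2 hq0.le)
        rw [trRpow_of_isHermitian (hρ i).isHermitian]
        exact (hρ i).sum_eigenvalues_rpow_le hH.eigenvectorUnitary.2 hq0.le hq1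
    _ ≤ trRpow (∑ i, (p i : ℂ) • ρ i) q ^ q⁻¹ := by
        simp only [trRpow_of_isHermitian hH, heig]
        exact sum_mul_rpow_sum_rpow_le hq0 hq1 p hp _ hdiag

/-- Concavity of `ρ ↦ (Tr ρ^q)^s - 1` on density matrices, for `0 < q < 1`, `0 < qs < 1`. -/
theorem stmt3 (d n : ℕ) (q s : ℝ) (hq0 : 0 < q) (hq1 : q < 1)
    (hqs0 : 0 < q * s) (hqs1 : q * s < 1)
    (ρ : Fin n → Matrix (Fin d) (Fin d) ℂ)
    (hpsd : ∀ i, (ρ i).PosSemidef) (htr : ∀ i, (ρ i).trace = 1)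
    (p : Fin n → ℝ) (hp : ∀ i, 0 ≤ p i) (hpsum : ∑ i, p i = 1) :
    ∑ i, p i * (trRpow (ρ i) q ^ s - 1) ≤
      trRpow (∑ i, (p i : ℂ) • ρ i) q ^ s - 1 := by
  have hpow {x : ℝ} (hx : 0 ≤ x) : x ^ s = (x ^ q⁻¹) ^ (q * s) := by
    rw [← Real.rpow_mul hx, inv_mul_cancel_left₀ hq0.ne']
  have hroot (i : Fin n) : 0 ≤ trRpow (ρ i) q ^ q⁻¹ :=
    Real.rpow_nonneg (trRpow_nonneg (hpsd i) q) _
  simp only [mul_sub, mul_one, Finset.sum_sub_distrib, hpsum]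
  refine sub_le_sub_right ?_ 1
  calc ∑ i, p i * trRpow (ρ i) q ^ s
      = ∑ i, p i * (trRpow (ρ i) q ^ q⁻¹) ^ (q * s) := by
        simp only [hpow (trRpow_nonneg (hpsd _) q)]
    _ ≤ (∑ i, p i * trRpow (ρ i) q ^ q⁻¹) ^ (q * s) :=
        (Real.concaveOn_rpow hqs0.le hqs1.le).le_map_sum (fun i _ ↦ hp i) hpsum fun i _ ↦ hroot i
    _ ≤ (trRpow (∑ i, (p i : ℂ) • ρ i) q ^ q⁻¹) ^ (q * s) :=
        Real.rpow_le_rpow (Finset.sum_nonneg fun i _ ↦ mul_nonneg (hp i) (hroot i))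
          (sum_mul_trRpow_rpow_inv_le hq0 hq1.le hpsd hp) hqs0.le
    _ = trRpow (∑ i, (p i : ℂ) • ρ i) q ^ s :=
        (hpow (trRpow_nonneg (Matrix.PosSemidef.sum_ofReal_smul hpsd hp) q)).symm
end

section
/- Let q ≥ 2, 0 < s ≤ 1 and 1 ≤ qs ≤ 3, and let x, y ≥ 0 satisfy x² + y² ≤ 1. Then h_{q,s}(√(x² + y²)) ≥ h_{q,s}(x) + h_{q,s}(y), where h_{q,s}(x) = [1 − (((1+√(1−x²))/2)^q + ((1−√(1−x²))/2)^q)^s]/(1 − 2^{s(1−q)}). -/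
/-- The function `h_{q,s}` relating concurrence to the normalized
unified (q,s)-concurrence. -/
noncomputable def hqs (q s x : ℝ) : ℝ :=
  (1 - (((1 + Real.sqrt (1 - x ^ 2)) / 2) ^ q +
      ((1 - Real.sqrt (1 - x ^ 2)) / 2) ^ q) ^ s) /
    (1 - (2 : ℝ) ^ (s * (1 - q)))

namespace Real

theorem convexOn_sinh : ConvexOn ℝ (Set.Ici 0) sinh := by
  refine MonotoneOn.convexOn_of_deriv (convex_Ici 0) continuous_sinh.continuousOn
    differentiable_sinh.differentiableOn ?_
  rw [deriv_sinh, interior_Ici]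
  intro x hx y hy hxy
  rw [cosh_le_cosh, abs_of_pos hx, abs_of_pos hy]
  exact hxy

theorem tanh_le_self {x : ℝ} (hx : 0 ≤ x) : tanh x ≤ x := by
  have hd (y : ℝ) : HasDerivAt (fun y => sinh y - y * cosh y) (-(y * sinh y)) y := by
    convert! (hasDerivAt_sinh y).sub ((hasDerivAt_id y).mul (hasDerivAt_cosh y)) using 1
    simp
  have hanti : AntitoneOn (fun y => sinh y - y * cosh y) (Set.Ici 0) := by
    refine antitoneOn_of_deriv_nonpos (convex_Ici 0)
      (fun y _ => (hd y).continuousAt.continuousWithinAt)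
      (fun y _ => (hd y).differentiableAt.differentiableWithinAt) fun y hy => ?_
    rw [interior_Ici] at hy
    rw [(hd y).deriv]
    exact neg_nonpos.2 (mul_nonneg (le_of_lt hy) (sinh_nonneg_iff.2 (le_of_lt hy)))
  have h := hanti (Set.mem_Ici.2 le_rfl) (Set.mem_Ici.2 hx) hx
  simp only [sinh_zero, zero_mul, sub_zero] at h
  rw [tanh_eq_sinh_div_cosh, div_le_iff₀ (cosh_pos x)]
  linarith

theorem tanh_le_tanh {x y : ℝ} (h : x ≤ y) : tanh x ≤ tanh y := by
  rw [tanh_eq_sinh_div_cosh, tanh_eq_sinh_div_cosh, div_le_div_iff₀ (cosh_pos x) (cosh_pos y)]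
  have := sinh_nonneg_iff.2 (sub_nonneg.2 h)
  rw [sinh_sub] at this
  linarith

theorem one_add_mul_coth_le {k θ : ℝ} (hk0 : 0 ≤ k) (hk1 : k ≤ 1) (hθ : 0 < θ) :
    (1 + k) * (cosh ((1 + k) * θ) / sinh ((1 + k) * θ)) ≤ cosh θ / sinh θ + k * tanh θ := by
  have hS : 0 < sinh θ := sinh_pos_iff.2 hθ
  have hC := cosh_pos θ
  have hS' : 0 < sinh ((1 + k) * θ) := sinh_pos_iff.2 (by positivity)
  have hconv : (1 + k) * sinh ((1 - k) * θ) ≤ (1 - k) * sinh ((1 + k) * θ) := by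
    have h1k : 0 < 1 + k := by linarith
    have h := convexOn_sinh.2 (Set.mem_Ici.2 (by positivity : 0 ≤ (1 + k) * θ))
      (Set.mem_Ici.2 le_rfl) (div_nonneg (by linarith) h1k.le : 0 ≤ (1 - k) / (1 + k))
      (by positivity : 0 ≤ 2 * k / (1 + k)) (by field_simp; ring)
    simp only [smul_eq_mul, sinh_zero, mul_zero, add_zero] at h
    rw [← mul_assoc, div_mul_cancel₀ _ h1k.ne', div_mul_eq_mul_div, le_div_iff₀ h1k] at h
    linarith
  rw [show (1 - k) * θ = 2 * θ - (1 + k) * θ by ring, sinh_sub, sinh_two_mul, cosh_two_mul]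
    at hconv
  have hsq := cosh_sq θ
  rw [tanh_eq_sinh_div_cosh, mul_div_assoc', mul_div_assoc', div_add_div _ _ hS.ne' hC.ne',
    div_le_div_iff₀ hS' (by positivity)]
  generalize sinh ((1 + k) * θ) = S' at *
  generalize cosh ((1 + k) * θ) = C' at *
  have : (1 - k) * S' * (cosh θ ^ 2) = (1 - k) * S' * (sinh θ ^ 2 + 1) := by rw [hsq]
  nlinarith

theorem mul_coth_sub_le {m θ : ℝ} (hm : 2 ≤ m) (hθ : 0 < θ) :
    m * (cosh (m * θ) / sinh (m * θ)) - 2 * (cosh (2 * θ) / sinh (2 * θ)) ≤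
      tanh (m * θ) * (m - 2) := by
  have hd (x : ℝ) (hx : 2 ≤ x) : HasDerivAt (fun x => x * (cosh (x * θ) / sinh (x * θ)))
      (cosh (x * θ) / sinh (x * θ) - x * θ / sinh (x * θ) ^ 2) x := by
    have hS : sinh (x * θ) ≠ 0 := (sinh_pos_iff.2 (by positivity)).ne'
    have hl : HasDerivAt (fun x : ℝ => x * θ) θ x := by
      simpa using (hasDerivAt_id x).mul_const θ
    convert! (hasDerivAt_id x).mul (hl.cosh.div hl.sinh hS) using 1
    have := cosh_sq (x * θ)
    simp only [id, Pi.div_apply]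
    field_simp
    linear_combination x * θ * this
  refine (convex_Icc 2 m).image_sub_le_mul_sub_of_deriv_le
    (f := fun x => x * (cosh (x * θ) / sinh (x * θ)))
    (fun x hx => (hd x hx.1).continuousAt.continuousWithinAt)
    (fun x hx => ?_) (fun x hx => ?_) 2 (Set.left_mem_Icc.2 hm) m (Set.right_mem_Icc.2 hm) hm
  · exact (hd x (interior_subset hx).1).differentiableAt.differentiableWithinAt
  · obtain ⟨hx2, hxm⟩ := interior_subset hx
    rw [(hd x hx2).deriv]
    refine le_trans ?_ (tanh_le_tanh (mul_le_mul_of_nonneg_right hxm hθ.le))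
    have hX : 0 < x * θ := by positivity
    have hS := sinh_pos_iff.2 hX
    have hC := cosh_pos (x * θ)
    have ht := tanh_le_self hX.le
    rw [tanh_eq_sinh_div_cosh] at ht ⊢
    generalize x * θ = X at *
    have : cosh X / sinh X - sinh X / cosh X = sinh X / cosh X / sinh X ^ 2 := by
      have := cosh_sq X
      field_simp
      linear_combination this
    have h2 : sinh X / cosh X / sinh X ^ 2 ≤ X / sinh X ^ 2 := by gcongr
    linarith

end Real

open Real

/-- The logarithm, up to an additive constant, of minus the derivative of
`u ↦ (((1 + √(1 - u)) / 2) ^ q + ((1 - √(1 - u)) / 2) ^ q) ^ s` at `u = 1 / cosh θ ^ 2`. -/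
noncomputable def logSlope (q s θ : ℝ) : ℝ :=
  (s - 1) * log (cosh (q * θ)) + log (sinh ((q - 1) * θ)) +
    (2 - q * s) * log (cosh θ) - log (sinh θ)

theorem logSlope_deriv_nonpos {q s θ : ℝ} (hq : 2 ≤ q) (hs : s ≤ 1) (hqs : q * s ≤ 3)
    (hθ : 0 < θ) :
    (s - 1) * (q * tanh (q * θ)) +
      (q - 1) * (cosh ((q - 1) * θ) / sinh ((q - 1) * θ)) +
      (2 - q * s) * tanh θ - cosh θ / sinh θ ≤ 0 := by
  have hmono : tanh θ ≤ tanh (q * θ) := tanh_le_tanh (by nlinarith)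
  rcases le_total q 3 with h3 | h3
  · have h := one_add_mul_coth_le (k := q - 2) (by linarith) (by linarith) hθ
    rw [show 1 + (q - 2) = q - 1 by ring] at h
    have : 0 ≤ (1 - s) * q * (tanh (q * θ) - tanh θ) :=
      mul_nonneg (mul_nonneg (by linarith) (by linarith)) (by linarith)
    linarith
  · have h := mul_coth_sub_le (m := q - 1) (by linarith) hθ
    have hm : tanh ((q - 1) * θ) * (q - 1 - 2) ≤ tanh (q * θ) * (q - 1 - 2) :=
      mul_le_mul_of_nonneg_right (tanh_le_tanh (by nlinarith)) (by linarith)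
    have h2 : 2 * (cosh (2 * θ) / sinh (2 * θ)) = tanh θ + cosh θ / sinh θ := by
      have hS : 0 < sinh θ := sinh_pos_iff.2 hθ
      have hC := cosh_pos θ
      rw [sinh_two_mul, cosh_two_mul, tanh_eq_sinh_div_cosh]
      field_simp
      ring
    have : 0 ≤ (3 - q * s) * (tanh (q * θ) - tanh θ) :=
      mul_nonneg (by linarith) (by linarith)
    linarith

theorem antitoneOn_logSlope {q s : ℝ} (hq : 2 ≤ q) (hs : s ≤ 1) (hqs : q * s ≤ 3) :
    AntitoneOn (logSlope q s) (Set.Ioi 0) := by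
  have hd (θ : ℝ) (hθ : 0 < θ) : HasDerivAt (logSlope q s)
      ((s - 1) * (q * tanh (q * θ)) +
        (q - 1) * (cosh ((q - 1) * θ) / sinh ((q - 1) * θ)) +
        (2 - q * s) * tanh θ - cosh θ / sinh θ) θ := by
    have hl (c : ℝ) : HasDerivAt (fun θ : ℝ => c * θ) c θ := by
      simpa using (hasDerivAt_id θ).const_mul c
    have h1 := ((hl q).cosh.log (cosh_pos _).ne').const_mul (s - 1)
    have h2 := (hl (q - 1)).sinh.log
      (sinh_pos_iff.2 (mul_pos (by linarith) hθ)).ne'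
    have h3 := ((hasDerivAt_cosh θ).log (cosh_pos _).ne').const_mul (2 - q * s)
    have h4 := (hasDerivAt_sinh θ).log (sinh_pos_iff.2 hθ).ne'
    convert! ((h1.add h2).add h3).sub h4 using 1
    rw [tanh_eq_sinh_div_cosh, tanh_eq_sinh_div_cosh]
    ring
  refine antitoneOn_of_deriv_nonpos (convex_Ioi 0)
    (fun θ hθ => (hd θ hθ).continuousAt.continuousWithinAt)
    (fun θ hθ => ?_) fun θ hθ => ?_
  · rw [interior_Ioi] at hθ
    exact (hd θ hθ).differentiableAt.differentiableWithinAt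
  · rw [interior_Ioi] at hθ
    rw [(hd θ hθ).deriv]
    exact logSlope_deriv_nonpos hq hs hqs hθ

theorem slope_tanh_eq_exp_logSlope {q s θ : ℝ} (hq : 1 < q) (hθ : 0 < θ) :
    (((1 + tanh θ) / 2) ^ q + ((1 - tanh θ) / 2) ^ q) ^ (s - 1) *
      (((1 + tanh θ) / 2) ^ (q - 1) - ((1 - tanh θ) / 2) ^ (q - 1)) / tanh θ =
    exp (logSlope q s θ + ((s - 1) * (1 - q) + (2 - q)) * log 2) := by
  have hC := cosh_pos θ
  have hS : 0 < sinh θ := sinh_pos_iff.2 hθ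
  have hCq := cosh_pos (q * θ)
  have hSm : 0 < sinh ((q - 1) * θ) := sinh_pos_iff.2 (mul_pos (by linarith) hθ)
  have ha : (1 + tanh θ) / 2 = exp θ / (2 * cosh θ) := by
    rw [tanh_eq_sinh_div_cosh, ← cosh_add_sinh]
    field_simp
  have hb : (1 - tanh θ) / 2 = exp (-θ) / (2 * cosh θ) := by
    rw [tanh_eq_sinh_div_cosh, ← cosh_sub_sinh]
    field_simp
  have hG : ((1 + tanh θ) / 2) ^ q + ((1 - tanh θ) / 2) ^ q =
      2 * cosh (q * θ) / (2 * cosh θ) ^ q := by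
    rw [ha, hb, div_rpow (exp_pos _).le (by positivity), div_rpow (exp_pos _).le (by positivity),
      ← exp_mul, ← exp_mul, cosh_eq (q * θ), ← add_div]
    ring_nf
  have hN : ((1 + tanh θ) / 2) ^ (q - 1) - ((1 - tanh θ) / 2) ^ (q - 1) =
      2 * sinh ((q - 1) * θ) / (2 * cosh θ) ^ (q - 1) := by
    rw [ha, hb, div_rpow (exp_pos _).le (by positivity), div_rpow (exp_pos _).le (by positivity),
      ← exp_mul, ← exp_mul, sinh_eq ((q - 1) * θ), ← sub_div]
    ring_nf
  rw [hG, hN, tanh_eq_sinh_div_cosh, ← exp_log (x := _ / _) (by positivity)]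
  congr 1
  rw [log_div (by positivity) (by positivity), log_mul (by positivity) (by positivity),
    log_rpow (by positivity), log_div (by positivity) (by positivity),
    log_div (by positivity) (by positivity), log_div (by positivity) (by positivity),
    log_rpow (by positivity), log_rpow (by positivity), log_mul (by positivity) (by positivity),
    log_mul (by positivity) (by positivity), log_mul (by positivity) (by positivity), logSlope]
  ring

theorem concaveOn_rpow_add_rpow_sqrt {q s : ℝ} (hq : 2 ≤ q) (hs0 : 0 < s) (hs1 : s ≤ 1)
    (hqs : q * s ≤ 3) :
    ConcaveOn ℝ (Set.Icc 0 1) fun u : ℝ =>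
      (((1 + √(1 - u)) / 2) ^ q + ((1 - √(1 - u)) / 2) ^ q) ^ s := by
  have hq0 : 0 < q := by linarith
  have ht (u : ℝ) (hu : u ∈ Set.Ioo (0 : ℝ) 1) : √(1 - u) ∈ Set.Ioo (0 : ℝ) 1 :=
    ⟨sqrt_pos.2 (by linarith [hu.2]), (sqrt_lt' one_pos).2 (by linarith [hu.1])⟩
  have hd (u : ℝ) (hu : u ∈ Set.Ioo (0 : ℝ) 1) : HasDerivAt
      (fun u : ℝ => (((1 + √(1 - u)) / 2) ^ q + ((1 - √(1 - u)) / 2) ^ q) ^ s)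
      (-(q * s / 4) * exp (logSlope q s (artanh √(1 - u)) +
        ((s - 1) * (1 - q) + (2 - q)) * log 2)) u := by
    obtain ⟨ht0, ht1⟩ := ht u hu
    have hr : HasDerivAt (fun u : ℝ => √(1 - u)) (-1 / (2 * √(1 - u))) u :=
      ((hasDerivAt_id u).const_sub 1).sqrt (sub_pos.2 hu.2).ne'
    have ha : 0 < (1 + √(1 - u)) / 2 := by positivity
    have hb : 0 < (1 - √(1 - u)) / 2 := by linarith
    have hda := ((hr.const_add 1).div_const 2).rpow_const (p := q) (Or.inl ha.ne')
    have hdb := ((hr.const_sub 1).div_const 2).rpow_const (p := q) (Or.inl hb.ne')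
    have h := (hda.add hdb).rpow_const (p := s)
      (Or.inl (add_pos (rpow_pos_of_pos ha q) (rpow_pos_of_pos hb q)).ne')
    rw [← slope_tanh_eq_exp_logSlope (by linarith) (artanh_pos ⟨ht0, ht1⟩),
      tanh_artanh ⟨by linarith, ht1⟩]
    convert! h using 1
    simp only [Pi.add_apply]
    field_simp
    ring
  refine AntitoneOn.concaveOn_of_deriv (convex_Icc 0 1) (Continuous.continuousOn ?_) ?_ ?_
  · have hc : Continuous fun u : ℝ => √(1 - u) := by fun_prop
    exact ((((continuous_const.add hc).div_const 2).rpow_const fun _ => Or.inr hq0.le).add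
      (((continuous_const.sub hc).div_const 2).rpow_const fun _ => Or.inr hq0.le)).rpow_const
        fun _ => Or.inr hs0.le
  · rw [interior_Icc]
    exact fun u hu => (hd u hu).differentiableAt.differentiableWithinAt
  · rw [interior_Icc]
    intro u hu v hv huv
    rw [(hd u hu).deriv, (hd v hv).deriv]
    have hle : artanh √(1 - v) ≤ artanh √(1 - u) :=
      artanh_le_artanh (by linarith [(ht v hv).1]) (ht u hu).2 (sqrt_le_sqrt (by linarith))
    have := antitoneOn_logSlope hq hs1 hqs (artanh_pos (ht v hv)) (artanh_pos (ht u hu)) hle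
    refine mul_le_mul_of_nonpos_left (exp_le_exp.2 (by linarith)) ?_
    exact neg_nonpos.2 (by positivity)

theorem ConcaveOn.map_add_add_map_zero_le {f : ℝ → ℝ} (hf : ConcaveOn ℝ (Set.Icc 0 1) f)
    {u v : ℝ} (hu : 0 ≤ u) (hv : 0 ≤ v) (huv : u + v ≤ 1) : f (u + v) + f 0 ≤ f u + f v := by
  rcases (add_nonneg hu hv).eq_or_lt with h0 | h0
  · obtain rfl : u = 0 := by linarith
    obtain rfl : v = 0 := by linarith
    simp
  have hmem : u + v ∈ Set.Icc (0 : ℝ) 1 := ⟨h0.le, huv⟩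
  have hzero : (0 : ℝ) ∈ Set.Icc (0 : ℝ) 1 := ⟨le_rfl, zero_le_one⟩
  have hsum : u / (u + v) + v / (u + v) = 1 := by rw [← add_div, div_self h0.ne']
  have h1 := hf.2 hmem hzero (div_nonneg hu h0.le) (div_nonneg hv h0.le) hsum
  have h2 := hf.2 hzero hmem (div_nonneg hu h0.le) (div_nonneg hv h0.le) hsum
  simp only [smul_eq_mul, mul_zero, add_zero, zero_add, div_mul_cancel₀ _ h0.ne'] at h1 h2
  linear_combination h1 + h2 - (f (u + v) + f 0) * hsum

/-- Superadditivity of `h_{q,s}` along `√(x² + y²)`, for `q ≥ 2`,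
`0 < s ≤ 1`, `1 ≤ qs ≤ 3`. -/
theorem stmt14 (q s : ℝ) (hq : 2 ≤ q) (hs0 : 0 < s) (hs1 : s ≤ 1)
    (hqs1 : 1 ≤ q * s) (hqs3 : q * s ≤ 3)
    (x y : ℝ) (hx : 0 ≤ x) (hy : 0 ≤ y) (hxy : x ^ 2 + y ^ 2 ≤ 1) :
    hqs q s x + hqs q s y ≤ hqs q s (Real.sqrt (x ^ 2 + y ^ 2)) := by
  have h := (concaveOn_rpow_add_rpow_sqrt hq hs0 hs1 hqs3).map_add_add_map_zero_le
    (sq_nonneg x) (sq_nonneg y) hxy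
  have hzero : (((1 + √(1 - 0)) / 2) ^ q + ((1 - √(1 - 0)) / 2) ^ q) ^ s = 1 := by
    norm_num [Real.zero_rpow (by linarith : q ≠ 0)]
  have hden : 0 ≤ 1 - (2 : ℝ) ^ (s * (1 - q)) :=
    sub_nonneg.2 (Real.rpow_le_one_of_one_le_of_nonpos one_le_two
      (mul_nonpos_of_nonneg_of_nonpos hs0.le (by linarith)))
  unfold hqs
  rw [Real.sq_sqrt (by positivity), ← add_div]
  refine div_le_div_of_nonneg_right ?_ hden
  rw [hzero] at h
  linarith
end
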